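/- arXiv:2204.07009 — 7 statements merged into one kernel-verified Lean document; each statement's English description precedes it below -/
import Mathlib

section
/- Let X be an open subset of ℝⁿ (viewed as EuclideanSpace ℝ (Fin n)). Let h : ℝⁿ → ℝⁿ be injective on X, differentiable at every point of X, with h '' X open and with an inverse map h⁻¹ : h '' X → X that is differentiable at every point of h '' X. Let g : ℝ → ℝ be differentiable with deriv g t > 0 for all t ∈ ℝ. Let f : ℝⁿ → ℝ be convex (on all of ℝⁿ) and differentiable. Then F := g ∘ f ∘ h is invex on X in the sense that every stationary point is a global minimum: for every x* ∈ X such that the Fréchet derivative of F at x* (within X) is zero, one has F(x*) ≤ F(z) for all z ∈ X. -/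
/-- A critical point of a convex function on a real normed space is a global minimum. -/
theorem ConvexOn.le_of_hasFDerivAt_zero {E : Type*} [NormedAddCommGroup E] [NormedSpace ℝ E]
    {f : E → ℝ} (hf : ConvexOn ℝ Set.univ f) {a : E}
    (ha : HasFDerivAt f (0 : E →L[ℝ] ℝ) a) (y : E) : f a ≤ f y := by
  have hconv : ConvexOn ℝ Set.univ (f ∘ AffineMap.lineMap (k := ℝ) a y) := by
    simpa using hf.comp_affineMap (AffineMap.lineMap (k := ℝ) a y)
  have hderiv : HasDerivAt (f ∘ AffineMap.lineMap (k := ℝ) a y) 0 0 := by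
    have ha' : HasFDerivAt f (0 : E →L[ℝ] ℝ) (AffineMap.lineMap (k := ℝ) a y 0) := by
      simpa using ha
    simpa using ha'.comp_hasDerivAt (0 : ℝ) AffineMap.hasDerivAt_lineMap
  have hslope := hconv.le_slope_of_hasDerivAt (Set.mem_univ 0) (Set.mem_univ 1) one_pos hderiv
  simpa [slope_def_field] using hslope

/-- Theorem 3 of the paper: invexity of the composition `F = g ∘ f ∘ h`.
Every stationary point of `F` on the open set `X` is a global minimum of `F` on `X`. -/
theorem invex_of_comp {n : ℕ} (X : Set (EuclideanSpace ℝ (Fin n)))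
    (hXopen : IsOpen X)
    (h : EuclideanSpace ℝ (Fin n) → EuclideanSpace ℝ (Fin n))
    (hinj : Set.InjOn h X)
    (hdiff : ∀ x ∈ X, DifferentiableAt ℝ h x)
    (himg_open : IsOpen (h '' X))
    (hinv : EuclideanSpace ℝ (Fin n) → EuclideanSpace ℝ (Fin n))
    (hinv_maps : ∀ y ∈ h '' X, hinv y ∈ X)
    (hinv_left : ∀ x ∈ X, hinv (h x) = x)
    (hinv_diff : ∀ y ∈ h '' X, DifferentiableAt ℝ hinv y)
    (g : ℝ → ℝ) (hg : Differentiable ℝ g) (hg' : ∀ t : ℝ, 0 < deriv g t)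
    (f : EuclideanSpace ℝ (Fin n) → ℝ)
    (hf_conv : ConvexOn ℝ Set.univ f) (hf_diff : Differentiable ℝ f)
    (F : EuclideanSpace ℝ (Fin n) → ℝ) (hF : F = g ∘ f ∘ h)
    (xstar : EuclideanSpace ℝ (Fin n)) (hxstar : xstar ∈ X)
    (hstat : fderivWithin ℝ F X xstar = 0) :
    ∀ z ∈ X, F xstar ≤ F z := by
  subst hF
  intro z _
  have hmem : h xstar ∈ h '' X := Set.mem_image_of_mem h hxstar
  have hh := (hdiff xstar hxstar).hasFDerivAt
  have hf := (hf_diff (h xstar)).hasFDerivAt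
  have hcomp := (hg (f (h xstar))).hasDerivAt.comp_hasFDerivAt xstar (hf.comp xstar hh)
  have hzero : (fderiv ℝ f (h xstar)).comp (fderiv ℝ h xstar) = 0 := by
    rw [fderivWithin_of_isOpen hXopen hxstar] at hstat
    exact (smul_eq_zero.mp (hcomp.fderiv.symm.trans hstat)).resolve_left (hg' _).ne'
  have hid : (fderiv ℝ h xstar).comp (fderiv ℝ hinv (h xstar)) =
      ContinuousLinearMap.id ℝ (EuclideanSpace ℝ (Fin n)) := by
    have hh' : HasFDerivAt h (fderiv ℝ h xstar) (hinv (h xstar)) := by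
      rwa [hinv_left xstar hxstar]
    refine (hh'.comp (h xstar) (hinv_diff _ hmem).hasFDerivAt).unique ?_
    refine (hasFDerivAt_id (h xstar)).congr_of_eventuallyEq ?_
    filter_upwards [himg_open.mem_nhds hmem]
    rintro _ ⟨x, hx, rfl⟩
    simp [hinv_left x hx]
  have hcrit : fderiv ℝ f (h xstar) = 0 := by
    rw [← ContinuousLinearMap.comp_id (fderiv ℝ f (h xstar)), ← hid,
      ← ContinuousLinearMap.comp_assoc, hzero, ContinuousLinearMap.zero_comp]
  exact (strictMono_of_deriv_pos hg').monotone
    (hf_conv.le_of_hasFDerivAt_zero (hcrit ▸ hf) (h z))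
end

section
/- Let f : ℝᵐ → ℝ (with ℝᵐ as EuclideanSpace ℝ (Fin m)) be strictly convex on all of ℝᵐ and continuous. If f attains its infimum, i.e., there exists x₀ with f(x₀) ≤ f(x) for all x, then for every α ∈ ℝ the sub-level set {x : f(x) ≤ α} is compact. -/
/-- If a convex function exceeds its value at `x₀` by at least `c - f x₀` on the unit sphere
around `x₀`, then it grows at least linearly outside the unit ball. -/
theorem ConvexOn.dist_mul_sub_le_of_le_on_sphere {E : Type*} [NormedAddCommGroup E]
    [NormedSpace ℝ E] {f : E → ℝ} (hf : ConvexOn ℝ Set.univ f) {x₀ : E} {c : ℝ}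
    (hc : ∀ y ∈ Metric.sphere x₀ 1, c ≤ f y) {x : E} (hx : 1 ≤ dist x x₀) :
    dist x x₀ * (c - f x₀) ≤ f x - f x₀ := by
  set r := dist x x₀ with hr
  have hr0 : 0 < r := by linarith
  have hinv : r⁻¹ ≤ 1 := inv_le_one_of_one_le₀ hx
  have hmem : (1 - r⁻¹) • x₀ + r⁻¹ • x ∈ Metric.sphere x₀ 1 := by
    have h : (1 - r⁻¹) • x₀ + r⁻¹ • x - x₀ = r⁻¹ • (x - x₀) := by module
    rw [mem_sphere_iff_norm, h, norm_smul, ← dist_eq_norm, ← hr, Real.norm_of_nonneg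
      (inv_nonneg.2 hr0.le), inv_mul_cancel₀ hr0.ne']
  have hle := (hc _ hmem).trans <| hf.2 (Set.mem_univ x₀) (Set.mem_univ x)
    (sub_nonneg.2 hinv) (inv_nonneg.2 hr0.le) (sub_add_cancel 1 r⁻¹)
  simp only [smul_eq_mul] at hle
  calc r * (c - f x₀) ≤ r * (r⁻¹ * (f x - f x₀)) := by gcongr; linarith
    _ = f x - f x₀ := mul_inv_cancel_left₀ hr0.ne' _

/-- A strictly convex continuous function on ℝᵐ attaining its infimum has compact
sub-level sets. -/
theorem isCompact_sublevel_of_strictConvex {m : ℕ}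
    (f : EuclideanSpace ℝ (Fin m) → ℝ)
    (hf_conv : StrictConvexOn ℝ Set.univ f) (hf_cont : Continuous f)
    (hmin : ∃ x₀ : EuclideanSpace ℝ (Fin m), ∀ x, f x₀ ≤ f x) :
    ∀ α : ℝ, IsCompact {x : EuclideanSpace ℝ (Fin m) | f x ≤ α} := by
  intro α
  obtain ⟨x₀, hx₀⟩ := hmin
  have hlt : ∀ y ∈ Metric.sphere x₀ 1, f x₀ < f y := by
    intro y hy
    by_contra! hle
    have hyx : y = x₀ := hf_conv.eq_of_isMinOn (fun z _ => hle.trans (hx₀ z))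
      (fun z _ => hx₀ z) (Set.mem_univ y) (Set.mem_univ x₀)
    simp [hyx] at hy
  obtain ⟨c, hc, hcle⟩ := (isCompact_sphere x₀ 1).exists_forall_le' hf_cont.continuousOn hlt
  refine (isCompact_closedBall x₀ (max 1 ((α - f x₀) / (c - f x₀)))).of_isClosed_subset
    (isClosed_le hf_cont continuous_const) fun x hx => ?_
  rw [Metric.mem_closedBall, le_max_iff, or_iff_not_imp_left, not_le]
  intro h
  rw [le_div_iff₀ (sub_pos.2 hc)]
  exact (hf_conv.convexOn.dist_mul_sub_le_of_le_on_sphere hcle h.le).trans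
    (sub_le_sub_right hx _)
end

section
/- Let f : ℝⁿ → ℝ (with ℝⁿ as EuclideanSpace ℝ (Fin n)) be continuous and strictly quasiconvex, with a global minimum at x* (f(x*) ≤ f(x) for all x), and suppose every sub-level set {x : f(x) ≤ α} is compact. Then for every α > f(x*) and every v ∈ ℝⁿ with ‖v‖ = 1, there exists a unique r > 0 such that f(x* + r•v) = α. -/
/-- A strictly quasiconvex function is strictly increasing along each ray from its minimum. -/
theorem strictMonoOn_ray_of_strictQuasiconvex {E : Type*} [AddCommGroup E] [Module ℝ E]
    {f : E → ℝ}
    (hf : ∀ x y : E, x ≠ y → ∀ l : ℝ, l ∈ Set.Ioo (0 : ℝ) 1 →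
        f (l • x + (1 - l) • y) < max (f x) (f y))
    {x₀ v : E} (hmin : ∀ x, f x₀ ≤ f x) (hv : v ≠ 0) :
    StrictMonoOn (fun r : ℝ => f (x₀ + r • v)) (Set.Ici 0) := by
  have between : ∀ b : ℝ, 0 < b → ∀ l ∈ Set.Ioo (0 : ℝ) 1,
      f (x₀ + (l * b) • v) < f (x₀ + b • v) := by
    intro b hb l hl
    have hne : x₀ + b • v ≠ x₀ := by simp [hb.ne', hv]
    have h := hf _ _ hne l hl
    rw [max_eq_left (hmin _)] at h
    convert h using 2
    module
  intro a ha b _ hab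
  have hb : 0 < b := lt_of_le_of_lt ha hab
  rcases (Set.mem_Ici.mp ha).eq_or_lt with rfl | ha'
  · simpa using (hmin _).trans_lt (between b hb (1 / 2) (by norm_num))
  · simpa [div_mul_cancel₀ a hb.ne'] using
      between b hb (a / b) ⟨div_pos ha' hb, (div_lt_one hb).mpr hab⟩

/-- A ray leaves every bounded set. -/
theorem Bornology.IsBounded.exists_pos_add_smul_notMem {E : Type*} [NormedAddCommGroup E]
    [NormedSpace ℝ E] {s : Set E} (hs : Bornology.IsBounded s) (x₀ : E) {v : E} (hv : ‖v‖ = 1) :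
    ∃ r : ℝ, 0 < r ∧ x₀ + r • v ∉ s := by
  obtain ⟨R, hR, hsR⟩ := hs.exists_pos_norm_le
  have hr : 0 < R + ‖x₀‖ + 1 := by positivity
  refine ⟨R + ‖x₀‖ + 1, hr, fun hmem => ?_⟩
  have h := norm_sub_le (x₀ + (R + ‖x₀‖ + 1) • v) x₀
  rw [add_sub_cancel_left, norm_smul, hv, Real.norm_of_nonneg hr.le] at h
  linarith [hsR _ hmem]

/-- Every ray from the minimum of a continuous strictly quasiconvex function with compact
sub-level sets intersects each level set `{x : f x = α}`, `α > f x*`, exactly once. -/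
theorem existsUnique_radius_on_ray {n : ℕ}
    (f : EuclideanSpace ℝ (Fin n) → ℝ) (hf_cont : Continuous f)
    (hf_quasi : ∀ x y : EuclideanSpace ℝ (Fin n), x ≠ y → ∀ l : ℝ, l ∈ Set.Ioo (0 : ℝ) 1 →
        f (l • x + (1 - l) • y) < max (f x) (f y))
    (xstar : EuclideanSpace ℝ (Fin n)) (hmin : ∀ x, f xstar ≤ f x)
    (hcompact : ∀ α : ℝ, IsCompact {x : EuclideanSpace ℝ (Fin n) | f x ≤ α})
    (α : ℝ) (hα : f xstar < α)
    (v : EuclideanSpace ℝ (Fin n)) (hv : ‖v‖ = 1) :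
    ∃! r : ℝ, 0 < r ∧ f (xstar + r • v) = α := by
  have hv₀ : v ≠ 0 := norm_ne_zero_iff.mp (by simp [hv])
  have hmono := strictMonoOn_ray_of_strictQuasiconvex hf_quasi hmin hv₀
  obtain ⟨R, hR, hRα⟩ := (hcompact α).isBounded.exists_pos_add_smul_notMem xstar hv
  have hcont : Continuous fun r : ℝ => f (xstar + r • v) := by fun_prop
  obtain ⟨r, hr, hrα⟩ := intermediate_value_Ioo hR.le hcont.continuousOn
    (show α ∈ Set.Ioo _ _ from ⟨by simpa using hα, not_le.mp hRα⟩)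
  exact ⟨r, ⟨hr.1, hrα⟩, fun s hs =>
    hmono.injOn hs.1.le hr.1.le (hs.2.trans hrα.symm)⟩
end

section
/- Let f : ℝⁿ → ℝ (with ℝⁿ as EuclideanSpace ℝ (Fin n), n ≥ 1) be continuous and strictly convex on all of ℝⁿ, with a global minimum at x*, and let α > f(x*). Then there exists a homeomorphism φ from the unit sphere {v : ‖v‖ = 1} of ℝⁿ onto the level set {x : f(x) = α} such that for every unit vector v there exists r > 0 with φ(v) = x* + r•v. -/
section Rays

variable {E : Type*} [NormedAddCommGroup E] [NormedSpace ℝ E] {f : E → ℝ} {x₀ v : E}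

theorem ConvexOn.ray_le (hf : ConvexOn ℝ Set.univ f) {s t : ℝ} (hs : 0 ≤ s) (hst : s ≤ t)
    (ht : 0 < t) : t * (f (x₀ + s • v) - f x₀) ≤ s * (f (x₀ + t • v) - f x₀) := by
  have h := hf.2 (Set.mem_univ x₀) (Set.mem_univ (x₀ + t • v))
    (sub_nonneg.2 ((div_le_one ht).2 hst)) (div_nonneg hs ht.le) (sub_add_cancel 1 (s / t))
  have e : (1 - s / t) • x₀ + (s / t) • (x₀ + t • v) = x₀ + s • v := by
    rw [smul_add, smul_smul, div_mul_cancel₀ _ ht.ne', ← add_assoc, ← add_smul]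
    simp
  rw [e, smul_eq_mul, smul_eq_mul] at h
  have h' := mul_le_mul_of_nonneg_left h ht.le
  have e' : t * ((1 - s / t) * f x₀ + s / t * f (x₀ + t • v))
      = (t - s) * f x₀ + s * f (x₀ + t • v) := by
    field_simp
  linarith

theorem StrictConvexOn.lt_of_forall_le (hf : StrictConvexOn ℝ Set.univ f)
    (hmin : ∀ x, f x₀ ≤ f x) {y : E} (hy : y ≠ x₀) : f x₀ < f y := by
  refine (hmin y).lt_of_ne fun h => hy ?_
  exact hf.eq_of_isMinOn (fun x _ => h ▸ hmin x) (fun x _ => hmin x)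
    (Set.mem_univ y) (Set.mem_univ x₀)

theorem StrictConvexOn.strictMonoOn_ray (hf : StrictConvexOn ℝ Set.univ f)
    (hmin : ∀ x, f x₀ ≤ f x) (hv : v ≠ 0) :
    StrictMonoOn (fun t : ℝ => f (x₀ + t • v)) (Set.Ici 0) := by
  intro s hs t _ hst
  have hs : 0 ≤ s := hs
  have ht : 0 < t := hs.trans_lt hst
  have h := hf.convexOn.ray_le (x₀ := x₀) (v := v) hs hst.le ht
  have hlt : f x₀ < f (x₀ + t • v) :=
    hf.lt_of_forall_le hmin (by simp [ht.ne', hv])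
  change f (x₀ + s • v) < f (x₀ + t • v)
  by_contra! hc
  nlinarith

theorem StrictConvexOn.exists_ray_eq (hf : StrictConvexOn ℝ Set.univ f) (hc : Continuous f)
    (hmin : ∀ x, f x₀ ≤ f x) (hv : v ≠ 0) {α : ℝ} (hα : f x₀ < α) :
    ∃ r : ℝ, 0 < r ∧ f (x₀ + r • v) = α := by
  have hlt : f x₀ < f (x₀ + (1 : ℝ) • v) := hf.lt_of_forall_le hmin (by simp [hv])
  obtain ⟨T, hT, hTα⟩ : ∃ T : ℝ, 1 ≤ T ∧ α - f x₀ ≤ T * (f (x₀ + (1 : ℝ) • v) - f x₀) :=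
    ⟨max 1 ((α - f x₀) / (f (x₀ + (1 : ℝ) • v) - f x₀)), le_max_left _ _,
      (div_le_iff₀ (sub_pos.2 hlt)).1 (le_max_right _ _)⟩
  have h := hf.convexOn.ray_le (x₀ := x₀) (v := v) zero_le_one hT (by linarith)
  obtain ⟨r, hr, hrα⟩ := intermediate_value_Icc (zero_le_one.trans hT)
    (f := fun t : ℝ => f (x₀ + t • v)) (by fun_prop)
    (show α ∈ Set.Icc _ _ from ⟨by simpa using hα.le, by linarith⟩)
  refine ⟨r, hr.1.lt_of_ne ?_, hrα⟩
  rintro rfl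
  simp [hα.ne] at hrα

theorem StrictConvexOn.exists_homeomorph_sphere_levelSet (hf : StrictConvexOn ℝ Set.univ f)
    (hc : Continuous f) (hmin : ∀ x, f x₀ ≤ f x) {α : ℝ} (hα : f x₀ < α) :
    ∃ φ : Metric.sphere (0 : E) 1 ≃ₜ {x : E // f x = α},
      ∀ v : Metric.sphere (0 : E) 1, ∃ r : ℝ, 0 < r ∧ (φ v : E) = x₀ + r • (v : E) := by
  have hv (v : Metric.sphere (0 : E) 1) : (v : E) ≠ 0 := ne_zero_of_mem_unit_sphere v
  choose r hr hrα using fun v => hf.exists_ray_eq hc hmin (hv v) hα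
  have hmono (v) := hf.strictMonoOn_ray hmin (hv v)
  have hrc : Continuous r := by
    refine continuous_iff_continuousAt.2 fun v => tendsto_order.2 ⟨fun a ha => ?_, fun b hb => ?_⟩
    · rcases lt_or_ge a 0 with h0 | h0
      · exact Filter.Eventually.of_forall fun w => h0.trans (hr w)
      have h : f (x₀ + a • (v : E)) < α := hrα v ▸ hmono v h0 (hr v).le ha
      have hcont : Continuous fun w : Metric.sphere (0 : E) 1 => f (x₀ + a • (w : E)) := by
        fun_prop
      filter_upwards [hcont.continuousAt.eventually_lt_const h] with w hw
      exact ((hmono w).lt_iff_lt h0 (hr w).le).1 (hw.trans_eq (hrα w).symm)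
    · have h0 : 0 ≤ b := (hr v).le.trans hb.le
      have h : α < f (x₀ + b • (v : E)) := hrα v ▸ hmono v (hr v).le h0 hb
      have hcont : Continuous fun w : Metric.sphere (0 : E) 1 => f (x₀ + b • (w : E)) := by
        fun_prop
      filter_upwards [hcont.continuousAt.eventually_const_lt h] with w hw
      exact ((hmono w).lt_iff_lt (hr w).le h0).1 ((hrα w).trans_lt hw)
  have hne (x : {x : E // f x = α}) : ‖(x : E) - x₀‖ ≠ 0 := by
    rw [norm_ne_zero_iff, sub_ne_zero]
    intro h
    exact hα.ne (h ▸ x.2)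
  let dir (x : {x : E // f x = α}) : Metric.sphere (0 : E) 1 :=
    ⟨‖(x : E) - x₀‖⁻¹ • ((x : E) - x₀), by
      rw [mem_sphere_zero_iff_norm, norm_smul, norm_inv, norm_norm, inv_mul_cancel₀ (hne x)]⟩
  have hdir (x : {x : E // f x = α}) : x₀ + ‖(x : E) - x₀‖ • (dir x : E) = x := by
    simp [dir, smul_inv_smul₀ (hne x)]
  refine ⟨{ toFun := fun v => ⟨x₀ + r v • (v : E), hrα v⟩
            invFun := dir
            left_inv := fun v => ?_
            right_inv := fun x => ?_
            continuous_toFun := by fun_prop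
            continuous_invFun := ?_ }, fun v => ⟨r v, hr v, rfl⟩⟩
  · ext1
    simp [dir, norm_smul, abs_of_pos (hr v), inv_smul_smul₀ (hr v).ne']
  · have h : r (dir x) = ‖(x : E) - x₀‖ := by
      refine (hmono (dir x)).injOn (hr _).le (norm_nonneg _) ?_
      simp only [hrα, hdir, x.2]
    ext1
    simp only [h, hdir]
  · exact Continuous.subtype_mk (Continuous.smul (Continuous.inv₀ (by fun_prop) hne)
      (by fun_prop)) _

end Rays

/-- Level sets of a continuous strictly convex function admit a global hyper-spherical
parameterisation centred at the minimum: the unit sphere is homeomorphic to the level set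
via a map sending each unit direction `v` to the point `x* + r • v` on the level set. -/
theorem levelSet_homeomorph_sphere {n : ℕ} (hn : 1 ≤ n)
    (f : EuclideanSpace ℝ (Fin n) → ℝ) (hf_cont : Continuous f)
    (hf_conv : StrictConvexOn ℝ Set.univ f)
    (xstar : EuclideanSpace ℝ (Fin n)) (hmin : ∀ x, f xstar ≤ f x)
    (α : ℝ) (hα : f xstar < α) :
    ∃ φ : Metric.sphere (0 : EuclideanSpace ℝ (Fin n)) 1 ≃ₜ
        {x : EuclideanSpace ℝ (Fin n) // f x = α},
      ∀ v : Metric.sphere (0 : EuclideanSpace ℝ (Fin n)) 1,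
        ∃ r : ℝ, 0 < r ∧ (φ v : EuclideanSpace ℝ (Fin n)) = xstar + r • (v : EuclideanSpace ℝ (Fin n)) := by
  exact hf_conv.exists_homeomorph_sphere_levelSet hf_cont hmin hα
end

section
/- Let f : ℝⁿ → ℝ (with ℝⁿ as EuclideanSpace ℝ (Fin n), n ≥ 2) be continuous and strictly convex on all of ℝⁿ, with a global minimum at x*, and let α > f(x*). Then the level set {x : f(x) = α} is path-connected. -/
open Set Filter Topology

section Ray

variable {E : Type*} [AddCommGroup E] [Module ℝ E] {f : E → ℝ} {x u : E}

/-- Along a ray, the secant slopes of a convex function from the base point are monotone. -/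
theorem ConvexOn.mul_sub_le_mul_sub_ray (hf : ConvexOn ℝ univ f) (x u : E) {s t : ℝ}
    (hs : 0 ≤ s) (hst : s ≤ t) (ht : 0 < t) :
    t * (f (x + s • u) - f x) ≤ s * (f (x + t • u) - f x) := by
  have h := hf.2 (mem_univ x) (mem_univ (x + t • u))
    (sub_nonneg.2 ((div_le_one ht).2 hst)) (div_nonneg hs ht.le) (by ring)
  have hpt : (1 - s / t) • x + (s / t) • (x + t • u) = x + s • u := by
    rw [smul_add, smul_smul, div_mul_cancel₀ _ ht.ne', ← add_assoc, ← add_smul]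
    simp
  rw [hpt, smul_eq_mul, smul_eq_mul] at h
  calc t * (f (x + s • u) - f x)
      ≤ t * ((1 - s / t) * f x + s / t * f (x + t • u) - f x) := by gcongr
    _ = s * (f (x + t • u) - f x) := by field_simp; ring

/-- A convex function is strictly increasing along every ray from a strict minimizer. -/
theorem ConvexOn.strictMonoOn_ray (hf : ConvexOn ℝ univ f) (hmin : ∀ y, y ≠ x → f x < f y)
    (hu : u ≠ 0) : StrictMonoOn (fun t : ℝ => f (x + t • u)) (Ici 0) := by
  intro s hs t _ hst
  have hs : 0 ≤ s := hs
  have ht : 0 < t := hs.trans_lt hst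
  have h := hf.mul_sub_le_mul_sub_ray x u hs hst.le ht
  have hlt : f x < f (x + t • u) := hmin _ (by simp [ht.ne', hu])
  change f (x + s • u) < f (x + t • u)
  nlinarith [mul_pos (sub_pos.2 hst) (sub_pos.2 hlt)]

/-- A convex function tends to infinity along every ray from a strict minimizer. -/
theorem ConvexOn.tendsto_ray_atTop (hf : ConvexOn ℝ univ f) (hmin : ∀ y, y ≠ x → f x < f y)
    (hu : u ≠ 0) : Tendsto (fun t : ℝ => f (x + t • u)) atTop atTop := by
  have hlt : f x < f (x + u) := hmin _ (by simp [hu])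
  refine tendsto_atTop_mono' atTop ?_
    (tendsto_atTop_add_const_right atTop (f x)
      (tendsto_id.atTop_mul_const (sub_pos.2 hlt)))
  filter_upwards [eventually_ge_atTop 1] with t ht
  have h := hf.mul_sub_le_mul_sub_ray x u zero_le_one ht (one_pos.trans_le ht)
  simp only [one_smul, one_mul] at h
  simp only [id]
  linarith

end Ray

/-- Every level set of a continuous convex function above a strict minimum is path-connected
in dimension greater than one. -/
theorem ConvexOn.isPathConnected_levelSet {E : Type*} [NormedAddCommGroup E] [NormedSpace ℝ E]
    (hE : 1 < Module.rank ℝ E) {f : E → ℝ} {x : E} {α : ℝ} (hf : ConvexOn ℝ univ f)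
    (hcont : Continuous f) (hmin : ∀ y, y ≠ x → f x < f y) (hα : f x < α) :
    IsPathConnected {y | f y = α} := by
  have hex : ∀ u : E, ∃ t : ℝ, 0 < t ∧ (u ≠ 0 → f (x + t • u) = α) := by
    intro u
    by_cases hu : u = 0
    · exact ⟨1, one_pos, fun h => absurd hu h⟩
    obtain ⟨b, hb, hb0⟩ := ((hf.tendsto_ray_atTop hmin hu).eventually_ge_atTop α |>.and
      (eventually_ge_atTop 0)).exists
    obtain ⟨t, ht, hft⟩ := intermediate_value_Icc hb0
      (f := fun t : ℝ => f (x + t • u)) (by fun_prop) ⟨by simpa using hα.le, hb⟩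
    refine ⟨t, lt_of_le_of_ne ht.1 ?_, fun _ => hft⟩
    rintro rfl
    simp at hft
    exact hα.ne hft
  choose r hr hfr using hex
  have hr_cont : ContinuousOn r {0}ᶜ := by
    intro u hu
    have hu : u ≠ 0 := hu
    have hne : ∀ᶠ v in 𝓝[{0}ᶜ] u, v ≠ 0 := eventually_mem_nhdsWithin
    have hray : ∀ t : ℝ, Tendsto (fun v => f (x + t • v)) (𝓝[{0}ᶜ] u) (𝓝 (f (x + t • u))) :=
      fun t => Continuous.continuousWithinAt (by fun_prop)
    refine tendsto_order.2 ⟨fun a ha => ?_, fun b hb => ?_⟩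
    · rcases lt_or_ge a 0 with h0 | h0
      · exact Eventually.of_forall fun v => h0.trans (hr v)
      have hlt : f (x + a • u) < α :=
        hfr u hu ▸ hf.strictMonoOn_ray hmin hu h0 (hr u).le ha
      filter_upwards [hne, (hray a).eventually_lt_const hlt] with v hv hav
      rw [← hfr v hv] at hav
      exact ((hf.strictMonoOn_ray hmin hv).lt_iff_lt h0 (hr v).le).1 hav
    · have h0 : 0 ≤ b := ((hr u).trans hb).le
      have hlt : α < f (x + b • u) := by
        have h := hf.strictMonoOn_ray hmin hu (hr u).le h0 hb
        simpa only [hfr u hu] using h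
      filter_upwards [hne, (hray b).eventually_const_lt hlt] with v hv hbv
      rw [← hfr v hv] at hbv
      exact ((hf.strictMonoOn_ray hmin hv).lt_iff_lt (hr v).le h0).1 hbv
  have himage : (fun u => x + r u • u) '' {0}ᶜ = {y | f y = α} := by
    ext y
    constructor
    · rintro ⟨u, hu, rfl⟩
      exact hfr u hu
    · intro hy
      have hy : f y = α := hy
      have hu : y - x ≠ 0 := sub_ne_zero.2 fun h => hα.ne (h ▸ hy)
      refine ⟨y - x, hu, ?_⟩
      have h1 : r (y - x) = 1 := (hf.strictMonoOn_ray hmin hu).injOn (hr _).le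
        (mem_Ici.2 zero_le_one)
        (by simp [hfr _ hu, hy])
      simp [h1]
  rw [← himage]
  exact (isPathConnected_compl_singleton_of_one_lt_rank hE 0).image'
    (continuousOn_const.add (hr_cont.smul continuousOn_id))

/-- For `n ≥ 2`, every level set above the minimum value of a continuous strictly convex
function on ℝⁿ is path-connected. -/
theorem levelSet_isPathConnected {n : ℕ} (hn : 2 ≤ n)
    (f : EuclideanSpace ℝ (Fin n) → ℝ) (hf_cont : Continuous f)
    (hf_conv : StrictConvexOn ℝ Set.univ f)
    (xstar : EuclideanSpace ℝ (Fin n)) (hmin : ∀ x, f xstar ≤ f x)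
    (α : ℝ) (hα : f xstar < α) :
    IsPathConnected {x : EuclideanSpace ℝ (Fin n) | f x = α} := by
  refine hf_conv.convexOn.isPathConnected_levelSet ?_ hf_cont (fun y hy => ?_) hα
  · rw [← Module.finrank_eq_rank, finrank_euclideanSpace_fin]
    exact_mod_cast hn
  · refine lt_of_le_of_ne (hmin y) fun h => hy ?_
    exact hf_conv.eq_of_isMinOn (fun z _ => h ▸ hmin z) (fun z _ => hmin z)
      (mem_univ _) (mem_univ _)
end

section
/- Let h : ℝⁿ → ℝⁿ (with ℝⁿ as EuclideanSpace ℝ (Fin n), n ≥ 2) be a homeomorphism, let f : ℝⁿ → ℝ be continuous and strictly convex on all of ℝⁿ with a global minimum attained at some point, and let g : ℝ → ℝ be strictly monotone increasing. Then for every α ∈ ℝ, the level set {x : g(f(h(x))) = α} of the composition F = g ∘ f ∘ h is preconnected (i.e., connected or empty). -/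
open Filter Topology in
/-- In dimension at least two, the level sets of a continuous convex function with a strict
global minimum are preconnected: above the minimum, every ray from the minimizer meets the level
set exactly once, at a point that depends continuously on the direction. -/
theorem ConvexOn.isPreconnected_levelSet_of_strict_min {E : Type*} [NormedAddCommGroup E]
    [NormedSpace ℝ E] (hE : 1 < Module.rank ℝ E) {f : E → ℝ} (hf : ConvexOn ℝ Set.univ f)
    (hcont : Continuous f) {x₀ : E} (hmin : ∀ x, x ≠ x₀ → f x₀ < f x) (c : ℝ) :
    IsPreconnected {x | f x = c} := by
  rcases le_or_gt c (f x₀) with hc | hc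
  · refine Set.Subsingleton.isPreconnected fun x hx y hy => ?_
    have eq_min : ∀ z, f z = c → z = x₀ := fun z hz => by
      by_contra hne
      linarith [hmin z hne]
    rw [eq_min x hx, eq_min y hy]
  have hpos : ∀ u : E, u ≠ 0 → ∀ t : ℝ, 0 < t → f x₀ < f (x₀ + t • u) := fun u hu t ht =>
    hmin _ (by simp [hu, ht.ne'])
  have hsecant : ∀ (u : E) (s t : ℝ), 0 ≤ s → s ≤ t → 0 < t →
      t * (f (x₀ + s • u) - f x₀) ≤ s * (f (x₀ + t • u) - f x₀) := by
    intro u s t hs hst ht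
    have hconv := hf.2 (Set.mem_univ x₀) (Set.mem_univ (x₀ + t • u))
      (sub_nonneg.2 ((div_le_one ht).2 hst)) (div_nonneg hs ht.le) (sub_add_cancel 1 (s / t))
    have hpt : (1 - s / t) • x₀ + (s / t) • (x₀ + t • u) = x₀ + s • u := by
      rw [smul_add, smul_smul, div_mul_cancel₀ _ ht.ne', sub_smul, one_smul]
      abel
    rw [hpt, smul_eq_mul, smul_eq_mul] at hconv
    calc t * (f (x₀ + s • u) - f x₀)
        ≤ t * ((1 - s / t) * f x₀ + s / t * f (x₀ + t • u) - f x₀) := by gcongr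
      _ = s * (f (x₀ + t • u) - f x₀) := by field_simp; ring
  have hmono : ∀ u : E, u ≠ 0 → StrictMonoOn (fun t : ℝ => f (x₀ + t • u)) (Set.Ici 0) := by
    intro u hu s hs t _ hst
    have ht : 0 < t := lt_of_le_of_lt hs hst
    have h₁ := hsecant u s t hs hst.le ht
    have h₂ := hpos u hu t ht
    change f (x₀ + s • u) < f (x₀ + t • u)
    nlinarith
  have hray : ∀ u : E, u ≠ 0 → ∃ t : ℝ, 0 < t ∧ f (x₀ + t • u) = c := by
    intro u hu
    have hu₁ := sub_pos.2 (hpos u hu 1 one_pos)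
    obtain ⟨T, hT₁, hT⟩ : ∃ T : ℝ, 1 ≤ T ∧ c ≤ f (x₀ + T • u) := by
      refine ⟨max 1 ((c - f x₀) / (f (x₀ + (1 : ℝ) • u) - f x₀)), le_max_left _ _, ?_⟩
      set T := max 1 ((c - f x₀) / (f (x₀ + (1 : ℝ) • u) - f x₀))
      have hT₁ : 1 ≤ T := le_max_left _ _
      have h₁ := hsecant u 1 T zero_le_one hT₁ (by linarith)
      have h₂ := (div_le_iff₀ hu₁).1 (le_max_right 1 _ : _ ≤ T)
      linarith
    obtain ⟨t, ht, htc⟩ := intermediate_value_Icc (zero_le_one.trans hT₁)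
      (f := fun t : ℝ => f (x₀ + t • u)) (by fun_prop) (show c ∈ Set.Icc _ _ by simp [hc.le, hT])
    refine ⟨t, ht.1.lt_of_ne ?_, htc⟩
    rintro rfl
    simp [hc.ne] at htc
  choose! r hr_pos hr using hray
  have hr_cont : ContinuousOn r {0}ᶜ := by
    intro u hu
    refine tendsto_order.2 ⟨fun a ha => ?_, fun b hb => ?_⟩
    · rcases lt_or_ge a 0 with ha₀ | ha₀
      · filter_upwards [self_mem_nhdsWithin] with v hv using ha₀.trans (hr_pos v hv)
      · have hlt : f (x₀ + a • u) < c := hr u hu ▸ hmono u hu ha₀ (hr_pos u hu).le ha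
        have hev : ∀ᶠ v in 𝓝 u, f (x₀ + a • v) < c :=
          (show Continuous fun v => f (x₀ + a • v) by fun_prop).continuousAt.eventually_lt
            continuousAt_const hlt
        filter_upwards [self_mem_nhdsWithin, hev.filter_mono nhdsWithin_le_nhds] with v hv hvc
        rw [← hr v hv] at hvc
        exact ((hmono v hv).lt_iff_lt ha₀ (hr_pos v hv).le).1 hvc
    · have hb₀ : 0 ≤ b := ((hr_pos u hu).trans hb).le
      have hlt : c < f (x₀ + b • u) := by
        have h := hmono u hu (hr_pos u hu).le hb₀ hb
        simpa only [hr u hu] using h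
      have hev : ∀ᶠ v in 𝓝 u, c < f (x₀ + b • v) :=
        continuousAt_const.eventually_lt
          (show Continuous fun v => f (x₀ + b • v) by fun_prop).continuousAt hlt
      filter_upwards [self_mem_nhdsWithin, hev.filter_mono nhdsWithin_le_nhds] with v hv hvc
      rw [← hr v hv] at hvc
      exact ((hmono v hv).lt_iff_lt (hr_pos v hv).le hb₀).1 hvc
  have himage : {x | f x = c} = (fun u => x₀ + r u • u) '' {0}ᶜ := by
    ext x
    constructor
    · intro hx
      have hu : x - x₀ ≠ 0 := by
        rw [sub_ne_zero]
        rintro rfl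
        exact hc.ne hx
      have hr_one : r (x - x₀) = 1 := by
        refine (hmono _ hu).injOn (hr_pos _ hu).le (Set.mem_Ici.2 zero_le_one) ?_
        simpa [hr _ hu] using hx.symm
      exact ⟨x - x₀, hu, by simp [hr_one]⟩
    · rintro ⟨u, hu, rfl⟩
      exact hr u hu
  rw [himage]
  exact (isConnected_compl_singleton_of_one_lt_rank hE 0).isPreconnected.image _
    (continuousOn_const.add (hr_cont.smul continuousOn_id))

/-- The central claim of the paper: the level sets of `F = g ∘ f ∘ h`, where `h` is a
homeomorphism of ℝⁿ (n ≥ 2), `f` is continuous, strictly convex and attains its minimum,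
and `g` is strictly monotone increasing, are preconnected. -/
theorem levelSet_comp_isPreconnected {n : ℕ} (hn : 2 ≤ n)
    (h : EuclideanSpace ℝ (Fin n) ≃ₜ EuclideanSpace ℝ (Fin n))
    (f : EuclideanSpace ℝ (Fin n) → ℝ) (hf_cont : Continuous f)
    (hf_conv : StrictConvexOn ℝ Set.univ f)
    (hmin : ∃ x₀ : EuclideanSpace ℝ (Fin n), ∀ x, f x₀ ≤ f x)
    (g : ℝ → ℝ) (hg : StrictMono g) :
    ∀ α : ℝ, IsPreconnected {x : EuclideanSpace ℝ (Fin n) | g (f (h x)) = α} := by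
  intro α
  obtain ⟨x₀, hx₀⟩ := hmin
  have hstrict : ∀ x, x ≠ x₀ → f x₀ < f x := fun x hx =>
    (hx₀ x).lt_of_ne fun heq => hx <| hf_conv.eq_of_isMinOn
      (fun y _ => heq ▸ hx₀ y) (fun y _ => hx₀ y) (Set.mem_univ x) (Set.mem_univ x₀)
  have hrank : 1 < Module.rank ℝ (EuclideanSpace ℝ (Fin n)) := by
    rw [← Module.finrank_eq_rank, finrank_euclideanSpace_fin]
    exact_mod_cast hn
  by_cases hα : ∃ c, g c = α
  · obtain ⟨c, rfl⟩ := hα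
    simp only [hg.injective.eq_iff]
    exact h.isPreconnected_preimage.2
      (hf_conv.convexOn.isPreconnected_levelSet_of_strict_min hrank hf_cont hstrict c)
  · convert isPreconnected_empty
    exact Set.eq_empty_of_forall_notMem fun x hx => hα ⟨_, hx⟩
end

section
/- Let f : ℝᵐ → ℝ (with ℝᵐ as EuclideanSpace ℝ (Fin m)) be strictly convex on all of ℝᵐ and continuous, attaining its infimum, and let g : ℝ → ℝ be a continuous strictly monotone increasing surjection. Then for every α ∈ ℝ the level set {x : g(f(x)) = α} is compact. -/
/-- A continuous strictly convex function on a proper space that attains its infimum has compact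
sublevel sets. -/
theorem StrictConvexOn.isCompact_sublevel {E : Type*} [NormedAddCommGroup E] [NormedSpace ℝ E]
    [ProperSpace E] {f : E → ℝ} (hf : StrictConvexOn ℝ Set.univ f) (hc : Continuous f)
    {x₀ : E} (hmin : ∀ x, f x₀ ≤ f x) (c : ℝ) : IsCompact {x | f x ≤ c} := by
  have hlt : ∀ x ∈ Metric.sphere x₀ 1, f x₀ < f x := by
    intro x hx
    refine (hmin x).lt_of_ne fun h => ?_
    have hxx : x₀ = x := hf.eq_of_isMinOn (fun y _ => hmin y)
      (fun y _ => h ▸ hmin y) (Set.mem_univ _) (Set.mem_univ _)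
    simp [← hxx] at hx
  obtain ⟨b, hb, hbx⟩ := (isCompact_sphere x₀ 1).exists_forall_le' hc.continuousOn hlt
  refine (isCompact_closedBall x₀ (max 1 ((c - f x₀) / (b - f x₀)))).of_isClosed_subset
    (isClosed_le hc continuous_const) fun x (hx : f x ≤ c) => ?_
  rw [mem_closedBall_iff_norm, le_max_iff]
  refine or_iff_not_imp_left.2 fun hd => ?_
  rw [not_le] at hd
  have hpos : 0 < ‖x - x₀‖ := one_pos.trans hd
  have hinv : ‖x - x₀‖⁻¹ ≤ 1 := inv_le_one_of_one_le₀ hd.le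
  have hsphere : (1 - ‖x - x₀‖⁻¹) • x₀ + ‖x - x₀‖⁻¹ • x ∈ Metric.sphere x₀ 1 := by
    have : (1 - ‖x - x₀‖⁻¹) • x₀ + ‖x - x₀‖⁻¹ • x - x₀ = ‖x - x₀‖⁻¹ • (x - x₀) := by
      module
    rw [mem_sphere_iff_norm, this, norm_smul, norm_inv, norm_norm, inv_mul_cancel₀ hpos.ne']
  have hconv := hf.convexOn.2 (Set.mem_univ x₀) (Set.mem_univ x) (sub_nonneg.2 hinv)
    (inv_nonneg.2 hpos.le) (sub_add_cancel _ _)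
  have key : b - f x₀ ≤ ‖x - x₀‖⁻¹ * (c - f x₀) := by
    have h := (hbx _ hsphere).trans hconv
    have h' := mul_le_mul_of_nonneg_left hx (inv_nonneg.2 hpos.le)
    simp only [smul_eq_mul] at h
    linarith
  rw [le_div_iff₀ (sub_pos.2 hb)]
  rwa [inv_mul_eq_div, le_div_iff₀' hpos] at key


/-- Level sets of `g ∘ f` are compact, when `f` is strictly convex, continuous and attains
its infimum, and `g` is a continuous strictly monotone increasing surjection. -/
theorem isCompact_levelSet_comp {m : ℕ}
    (f : EuclideanSpace ℝ (Fin m) → ℝ)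
    (hf_conv : StrictConvexOn ℝ Set.univ f) (hf_cont : Continuous f)
    (hmin : ∃ x₀ : EuclideanSpace ℝ (Fin m), ∀ x, f x₀ ≤ f x)
    (g : ℝ → ℝ) (hg_cont : Continuous g) (hg_mono : StrictMono g)
    (hg_surj : Function.Surjective g) :
    ∀ α : ℝ, IsCompact {x : EuclideanSpace ℝ (Fin m) | g (f x) = α} := by
  intro α
  obtain ⟨x₀, hx₀⟩ := hmin
  obtain ⟨c, rfl⟩ := hg_surj α
  exact (hf_conv.isCompact_sublevel hf_cont hx₀ c).of_isClosed_subset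
    (isClosed_eq (hg_cont.comp hf_cont) continuous_const) fun x hx => (hg_mono.injective hx).le
end
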